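/- Assume that for each n, k ∈ ℕ there is an F-adapted martingale z^{n,k} with continuous paths and values in [0,1] such that z^{n,k}_t = P(C_n^k | F_t) almost surely for every t ≥ 0. Then for every γ > 0 the following are equivalent: (i) H_γ(ξ, τ) := Σ_{n,k} E[1_{C_n^k} · (log(1/z^{n,k}_{T_n}))^γ] < ∞; (ii) Σ_{n,k} E[1_{C_n^k} · (log(1/ inf_{t ≥ T_n} z^{n,k}_t))^γ] < ∞. -/

import Mathlib

open MeasureTheory
open scoped NNReal ENNReal

/-- The pathwise infimum of the process `z` over the random interval `[T, ∞)`. -/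
noncomputable def infAfter {Ω : Type*} (z : ℝ≥0 → Ω → ℝ) (T : Ω → ℝ≥0∞) (ω : Ω) : ℝ :=
  ⨅ t : {t : ℝ≥0 // T ω ≤ (t : ℝ≥0∞)}, z t.1 ω

lemma key_S {Ω : Type*} {𝒢 : MeasurableSpace Ω} (μ : Measure Ω) [IsProbabilityMeasure μ]
    (ℱ : Filtration ℝ≥0 𝒢) (C : Set Ω) (hC : MeasurableSet C) (z : ℝ≥0 → Ω → ℝ) (hmart : Martingale z ℱ μ)
    (hval : ∀ t ω, z t ω ∈ Set.Icc (0 : ℝ) 1)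
    (hz : ∀ t, z t =ᵐ[μ] μ[C.indicator (fun _ => (1 : ℝ)) | ℱ t]) (t : ℝ≥0) (S : Set Ω)
    (hS : MeasurableSet[ℱ t] S) : ∫⁻ ω in S, ENNReal.ofReal (z t ω) ∂μ = μ (C ∩ S) := by
  rw [← ofReal_integral_eq_lintegral_ofReal (hmart.integrable t).integrableOn
    (Filter.Eventually.of_forall fun ω => (hval t ω).1)]
  have h1 : ∫ ω in S, z t ω ∂μ = ∫ ω in S, (μ[C.indicator (fun _ => (1 : ℝ)) | ℱ t]) ω ∂μ :=
    integral_congr_ae (ae_restrict_of_ae (hz t))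
  rw [h1, setIntegral_condExp (ℱ.le t) ((integrable_const (1:ℝ)).indicator hC) hS,
    integral_indicator hC, setIntegral_const, smul_eq_mul, mul_one, Measure.real,
    Measure.restrict_apply hC, ENNReal.ofReal_toReal (measure_ne_top _ _)]

lemma aux_lt {Ω : Type*} {m : MeasurableSpace Ω} {f g : Ω → ℝ} (hf : Measurable f)
    (hg : Measurable g) (a : ℝ) : MeasurableSet {ω | f ω < a * g ω} :=
  measurableSet_lt hf (hg.const_mul a)

lemma key_discrete {Ω : Type*} {𝒢 : MeasurableSpace Ω} (μ ν : Measure Ω) [IsProbabilityMeasure μ]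
    (ℱ : Filtration ℝ≥0 𝒢) (C : Set Ω) (T : Ω → ℝ≥0∞)
    (hT : ∀ t : ℝ≥0, MeasurableSet[ℱ t] {ω | T ω ≤ (t : ℝ≥0∞)})
    (z w : ℝ≥0 → Ω → ℝ) 
    (hzm : ∀ t, Measurable[ℱ t] (z t)) (hwm : ∀ t, Measurable[ℱ t] (w t))
    (hzS : ∀ t S, MeasurableSet[ℱ t] S → ∫⁻ ω in S, ENNReal.ofReal (z t ω) ∂μ = μ (C ∩ S))
    (hwS : ∀ t S, MeasurableSet[ℱ t] S → ∫⁻ ω in S, ENNReal.ofReal (w t ω) ∂μ ≤ ν S)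
    (a : ℝ) (ha : 0 ≤ a) (g : ℕ → ℝ≥0) (hg : Monotone g) :
    μ (C ∩ {ω | ∃ i j, i ≤ j ∧ T ω ≤ g i ∧ (∀ l < i, ¬ T ω ≤ g l) ∧ z (g j) ω < a * w (g i) ω})
      ≤ ENNReal.ofReal a * ν Set.univ := by
  let A : ℕ → Set Ω := fun i => {ω | T ω ≤ g i ∧ ∀ l < i, ¬ T ω ≤ g l}
  let B : ℕ → ℕ → Set Ω := fun i j => {ω | z (g j) ω < a * w (g i) ω}
  let S : ℕ → ℕ → Set Ω := fun i j => A i ∩ {ω | i ≤ j ∧ ω ∈ B i j ∧ ∀ l < j, i ≤ l → ω ∉ B i l}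
  have hTj : ∀ i j, i ≤ j → MeasurableSet[ℱ (g j)] {ω | T ω ≤ g i} := fun i j hij =>
    ℱ.mono (hg hij) _ (hT _)
  have hA : ∀ i j, i ≤ j → MeasurableSet[ℱ (g j)] (A i) := by
    intro i j hij
    have : A i = {ω | T ω ≤ g i} ∩ ⋂ l, ⋂ (_ : l < i), {ω | T ω ≤ g l}ᶜ := by
      ext ω; simp [A]
    rw [this]
    exact (hTj i j hij).inter (MeasurableSet.iInter fun l => MeasurableSet.iInter fun hl =>
      (hTj l j (hl.le.trans hij)).compl)
  have hB : ∀ i j l, i ≤ l → j ≤ l → MeasurableSet[ℱ (g l)] (B i j) := by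
    intro i j l hi hj
    exact aux_lt ((hzm (g j)).mono (ℱ.mono (hg hj)) le_rfl)
      ((hwm (g i)).mono (ℱ.mono (hg hi)) le_rfl) a
  have hS : ∀ i j, MeasurableSet[ℱ (g j)] (S i j) := by
    intro i j
    by_cases hij : i ≤ j
    · have : S i j = A i ∩ (B i j ∩ ⋂ l, ⋂ (_ : l < j), ⋂ (_ : i ≤ l), (B i l)ᶜ) := by
        ext ω; simp [S, hij]
      rw [this]
      exact (hA i j hij).inter ((hB i j j hij le_rfl).inter (MeasurableSet.iInter fun l =>
        MeasurableSet.iInter fun hl => MeasurableSet.iInter fun _ => (hB i l j hij hl.le).compl))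
    · have : S i j = ∅ := by ext ω; simp [S, hij]
      rw [this]; exact @MeasurableSet.empty _ (ℱ (g j))
  have hSm : ∀ i j, MeasurableSet (S i j) := fun i j => ℱ.le _ _ (hS i j)
  have hSd : ∀ i, Pairwise (Function.onFun Disjoint (S i)) := by
    intro i j k hjk
    refine Set.disjoint_left.2 ?_
    rintro ω ⟨_, h1, h2, h3⟩ ⟨_, h4, h5, h6⟩
    rcases lt_or_gt_of_ne hjk with h | h
    · exact h6 j h h1 h2
    · exact h3 k h h4 h5
  have hAm : ∀ i, MeasurableSet (A i) := fun i => ℱ.le _ _ (hA i i le_rfl)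
  have hAd : Pairwise (Function.onFun Disjoint A) := by
    intro j k hjk
    refine Set.disjoint_left.2 ?_
    rintro ω ⟨h1, h2⟩ ⟨h4, h5⟩
    rcases lt_or_gt_of_ne hjk with h | h
    · exact h5 j h h1
    · exact h2 k h h4
  have hsub : C ∩ {ω | ∃ i j, i ≤ j ∧ T ω ≤ g i ∧ (∀ l < i, ¬ T ω ≤ g l) ∧
      z (g j) ω < a * w (g i) ω} ⊆ ⋃ i, ⋃ j, C ∩ S i j := by
    classical
    rintro ω ⟨hc, i, j, hij, h1, h2, h3⟩
    have hex : ∃ j, i ≤ j ∧ ω ∈ B i j := ⟨j, hij, h3⟩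
    refine Set.mem_iUnion.2 ⟨i, Set.mem_iUnion.2 ⟨Nat.find hex, hc, ⟨h1, h2⟩,
      (Nat.find_spec hex).1, (Nat.find_spec hex).2, fun l hl hil hb => Nat.find_min hex hl ⟨hil, hb⟩⟩⟩
  have hi : ∀ i, ∑' j, μ (C ∩ S i j) ≤ ENNReal.ofReal a * ν (A i) := by
    intro i
    calc ∑' j, μ (C ∩ S i j) = ∑' j, ∫⁻ ω in S i j, ENNReal.ofReal (z (g j) ω) ∂μ := by
          congr 1; ext j; rw [hzS _ _ (hS i j)]
      _ ≤ ∑' j, ∫⁻ ω in S i j, ENNReal.ofReal a * ENNReal.ofReal (w (g i) ω) ∂μ := by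
          refine ENNReal.tsum_le_tsum fun j => setLIntegral_mono' (hSm i j) ?_
          rintro ω ⟨_, _, h, _⟩
          rw [← ENNReal.ofReal_mul ha]
          exact ENNReal.ofReal_le_ofReal (le_of_lt h)
      _ = ∫⁻ ω in ⋃ j, S i j, ENNReal.ofReal a * ENNReal.ofReal (w (g i) ω) ∂μ :=
          (lintegral_iUnion (hSm i) (hSd i) _).symm
      _ ≤ ∫⁻ ω in A i, ENNReal.ofReal a * ENNReal.ofReal (w (g i) ω) ∂μ :=
          lintegral_mono_set (Set.iUnion_subset fun j => Set.inter_subset_left)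
      _ = ENNReal.ofReal a * ∫⁻ ω in A i, ENNReal.ofReal (w (g i) ω) ∂μ :=
          lintegral_const_mul' _ _ ENNReal.ofReal_ne_top
      _ ≤ _ := by gcongr; exact hwS _ _ (hA i i le_rfl)
  calc _ ≤ μ (⋃ i, ⋃ j, C ∩ S i j) := measure_mono hsub
    _ ≤ ∑' i, ∑' j, μ (C ∩ S i j) := (measure_iUnion_le _).trans
        (ENNReal.tsum_le_tsum fun i => measure_iUnion_le _)
    _ ≤ ∑' i, ENNReal.ofReal a * ν (A i) := ENNReal.tsum_le_tsum hi
    _ = ENNReal.ofReal a * ν (⋃ i, A i) := by rw [ENNReal.tsum_mul_left, measure_iUnion hAd hAm]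
    _ ≤ _ := by gcongr; exact Set.subset_univ _

lemma measure_eventually_le {Ω : Type*} {𝒢 : MeasurableSpace Ω} (μ : Measure Ω) (E : Set Ω)
    (D : ℕ → Set Ω) (K : ℝ≥0∞) (hD : ∀ m, μ (D m) ≤ K)
    (hE : ∀ ω ∈ E, ∀ᶠ m in Filter.atTop, ω ∈ D m) : μ E ≤ K := by
  have hsub : E ⊆ ⋃ M, ⋂ m, ⋂ (_ : M ≤ m), D m := by
    intro ω hω
    obtain ⟨M, hM⟩ := Filter.eventually_atTop.1 (hE ω hω)
    simp only [Set.mem_iUnion, Set.mem_iInter]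
    exact ⟨M, hM⟩
  have hmono : Monotone fun M => ⋂ m, ⋂ (_ : M ≤ m), D m := by
    intro M N hMN ω hω
    simp only [Set.mem_iInter] at hω ⊢
    exact fun m hm => hω m (hMN.trans hm)
  refine (measure_mono hsub).trans ?_
  rw [hmono.measure_iUnion]
  exact iSup_le fun M => (measure_mono (Set.iInter₂_subset M le_rfl)).trans (hD M)

lemma grid_tendsto (s : ℝ≥0) : Filter.Tendsto
    (fun m : ℕ => ((⌈(s : ℝ) * ((m : ℝ) + 1)⌉₊ : ℝ≥0) / ((m : ℝ≥0) + 1))) Filter.atTop (nhds s) := by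
  rw [← NNReal.tendsto_coe]
  have h := (tendsto_nat_ceil_mul_div_atTop (R := ℝ) s.2).comp
    (Filter.tendsto_atTop_add_const_right _ (1 : ℝ) tendsto_natCast_atTop_atTop)
  refine h.congr fun m => ?_
  simp

lemma key_cont {Ω : Type*} {𝒢 : MeasurableSpace Ω} (μ ν : Measure Ω) [IsProbabilityMeasure μ]
    (ℱ : Filtration ℝ≥0 𝒢) (C : Set Ω) (T : Ω → ℝ≥0∞)
    (hT : ∀ t : ℝ≥0, MeasurableSet[ℱ t] {ω | T ω ≤ (t : ℝ≥0∞)})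
    (z w : ℝ≥0 → Ω → ℝ)
    (hzm : ∀ t, Measurable[ℱ t] (z t)) (hwm : ∀ t, Measurable[ℱ t] (w t))
    (hzc : ∀ ω, Continuous fun t => z t ω) (hwc : ∀ ω, Continuous fun t => w t ω)
    (hzS : ∀ t S, MeasurableSet[ℱ t] S → ∫⁻ ω in S, ENNReal.ofReal (z t ω) ∂μ = μ (C ∩ S))
    (hwS : ∀ t S, MeasurableSet[ℱ t] S → ∫⁻ ω in S, ENNReal.ofReal (w t ω) ∂μ ≤ ν S)
    (a : ℝ) (ha : 0 ≤ a) :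
    μ (C ∩ {ω | ∃ t : ℝ≥0, T ω ≤ t ∧ z t ω < a * w (T ω).toNNReal ω})
      ≤ ENNReal.ofReal a * ν Set.univ := by
  let g : ℕ → ℕ → ℝ≥0 := fun m i => (i : ℝ≥0) / ((m : ℝ≥0) + 1)
  have hg : ∀ m, Monotone (g m) := by
    intro m i j hij
    simp only [g]
    gcongr
  refine measure_eventually_le μ _ _ _ (fun m => key_discrete μ ν ℱ C T hT z w hzm hwm hzS hwS a ha
    (g m) (hg m)) ?_
  rintro ω ⟨hc, t, hTt, hlt⟩
  have hfin : T ω ≠ ∞ := ne_top_of_le_ne_top ENNReal.coe_ne_top hTt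
  obtain ⟨s, hs⟩ : ∃ s : ℝ≥0, T ω = s := ⟨_, (ENNReal.coe_toNNReal hfin).symm⟩
  rw [hs, ENNReal.toNNReal_coe] at hlt
  have hst : s ≤ t := by rw [hs] at hTt; exact_mod_cast hTt
  have h1 := ((hzc ω).tendsto t).comp (grid_tendsto t)
  have h2 := (((hwc ω).tendsto s).comp (grid_tendsto s)).const_mul a
  filter_upwards [h1.eventually_lt h2 hlt] with m hm
  have hm0 : (0 : ℝ) < (m : ℝ) + 1 := by positivity
  have hle : ∀ l : ℕ, T ω ≤ g m l ↔ ⌈(s : ℝ) * ((m : ℝ) + 1)⌉₊ ≤ l := by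
    intro l
    rw [hs, ENNReal.coe_le_coe, Nat.ceil_le, ← NNReal.coe_le_coe]
    simp only [g]
    push_cast
    rw [le_div_iff₀ hm0]
  refine ⟨hc, ⌈(s : ℝ) * ((m : ℝ) + 1)⌉₊, ⌈(t : ℝ) * ((m : ℝ) + 1)⌉₊, ?_, ?_, ?_, hm⟩
  · apply Nat.ceil_mono
    have : (s : ℝ) ≤ t := by exact_mod_cast hst
    gcongr
  · exact (hle _).2 le_rfl
  · intro l hl
    rw [hle]
    omega

lemma bddBelow_after {Ω : Type*} (z : ℝ≥0 → Ω → ℝ) (T : Ω → ℝ≥0∞) (ω : Ω)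
    (h0 : ∀ t, 0 ≤ z t ω) :
    BddBelow (Set.range fun t : {t : ℝ≥0 // T ω ≤ (t : ℝ≥0∞)} => z t.1 ω) :=
  ⟨0, by rintro _ ⟨t, rfl⟩; exact h0 _⟩

lemma infAfter_le {Ω : Type*} (z : ℝ≥0 → Ω → ℝ) (T : Ω → ℝ≥0∞) (ω : Ω)
    (h0 : ∀ t, 0 ≤ z t ω) (hT : T ω ≠ ∞) : infAfter z T ω ≤ z (T ω).toNNReal ω :=
  ciInf_le (bddBelow_after z T ω h0) ⟨(T ω).toNNReal, (ENNReal.coe_toNNReal hT).ge⟩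

/-- the core estimate for a single martingale -/
lemma key_pos {Ω : Type*} {𝒢 : MeasurableSpace Ω} (μ : Measure Ω) [IsProbabilityMeasure μ]
    (ℱ : Filtration ℝ≥0 𝒢) (C : Set Ω) (T : Ω → ℝ≥0∞)
    (hT : ∀ t : ℝ≥0, MeasurableSet[ℱ t] {ω | T ω ≤ (t : ℝ≥0∞)})
    (hCT : ∀ ω ∈ C, T ω ≠ ∞)
    (z : ℝ≥0 → Ω → ℝ) (hzm : ∀ t, Measurable[ℱ t] (z t))
    (hzc : ∀ ω, Continuous fun t => z t ω)
    (hzS : ∀ t S, MeasurableSet[ℱ t] S → ∫⁻ ω in S, ENNReal.ofReal (z t ω) ∂μ = μ (C ∩ S)) :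
    ∀ᵐ ω ∂μ, ω ∈ C → 0 < infAfter z T ω := by
  have hb : ∀ a : ℝ, 0 ≤ a → μ (C ∩ {ω | ∃ t : ℝ≥0, T ω ≤ t ∧ z t ω < a * 1})
      ≤ ENNReal.ofReal a := by
    intro a ha
    have := key_cont μ μ ℱ C T hT z (fun _ _ => 1) hzm (fun _ => measurable_const) hzc
      (fun _ => continuous_const) hzS (fun t S _ => by simp) a ha
    simpa using this
  rw [ae_iff]
  refine le_antisymm ?_ (zero_le)
  refine ENNReal.le_of_forall_pos_le_add fun ε hε _ => ?_
  rw [zero_add]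
  refine (measure_mono ?_).trans ((hb ε ε.2).trans (by simp))
  intro ω hω
  simp only [Set.mem_setOf_eq, Classical.not_imp, not_lt] at hω
  refine ⟨hω.1, ?_⟩
  haveI : Nonempty {t : ℝ≥0 // T ω ≤ (t : ℝ≥0∞)} :=
    ⟨⟨(T ω).toNNReal, (ENNReal.coe_toNNReal (hCT ω hω.1)).ge⟩⟩
  obtain ⟨t, ht⟩ := exists_lt_of_ciInf_lt (lt_of_le_of_lt hω.2 (show (0 : ℝ) < ε from hε))
  exact ⟨t.1, t.2, by simpa using ht⟩

lemma const_fin (γ : ℝ) (hγ : 0 < γ) :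
    ∑' k : ℕ, ENNReal.ofReal (((k : ℝ) + 1) ^ γ) * ENNReal.ofReal (Real.exp (-(k : ℝ))) ≠ ∞ := by
  have hs := Real.summable_pow_mul_exp_neg_nat_mul ⌈γ⌉₊ one_pos
  have hs1 := ((summable_nat_add_iff 1).2 hs).mul_left (Real.exp 1)
  refine ne_top_of_le_ne_top hs1.tsum_ofReal_ne_top (ENNReal.tsum_le_tsum fun k => ?_)
  rw [← ENNReal.ofReal_mul (by positivity)]
  refine ENNReal.ofReal_le_ofReal ?_
  push_cast
  have h1 : ((k : ℝ) + 1) ^ γ ≤ ((k : ℝ) + 1) ^ ⌈γ⌉₊ := by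
    rw [← Real.rpow_natCast]
    exact Real.rpow_le_rpow_of_exponent_le (by linarith [k.cast_nonneg (α := ℝ)]) (Nat.le_ceil γ)
  have h2 : Real.exp (-(k : ℝ)) = Real.exp 1 * Real.exp (-1 * ((k : ℝ) + 1)) := by
    rw [← Real.exp_add]; congr 1; ring
  rw [h2]
  calc _ ≤ ((k : ℝ) + 1) ^ ⌈γ⌉₊ * (Real.exp 1 * Real.exp (-1 * ((k : ℝ) + 1))) := by gcongr
    _ = _ := by ring

lemma add_rpow_bound (a b γ : ℝ) (ha : 0 ≤ a) (hb : 0 ≤ b) (hγ : 0 < γ) :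
    (a + b) ^ γ ≤ 2 ^ γ * (a ^ γ + b ^ γ) := by
  have key : ∀ x y : ℝ, 0 ≤ x → 0 ≤ y → x ≤ y → (x + y) ^ γ ≤ 2 ^ γ * (x ^ γ + y ^ γ) := by
    intro x y hx hy h
    calc (x + y) ^ γ ≤ (2 * y) ^ γ := Real.rpow_le_rpow (by positivity) (by linarith) hγ.le
      _ = 2 ^ γ * y ^ γ := Real.mul_rpow (by norm_num) hy
      _ ≤ _ := by
        have := Real.rpow_nonneg hx γ
        gcongr; linarith
  rcases le_total a b with h | h
  · exact key a b ha hb h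
  · rw [add_comm a b, add_comm (a ^ γ)]; exact key b a hb ha h

lemma key_upper {Ω : Type*} {𝒢 : MeasurableSpace Ω} (μ : Measure Ω) [IsProbabilityMeasure μ]
    (ℱ : Filtration ℝ≥0 𝒢) (C : Set Ω) (hC : MeasurableSet C) (T : Ω → ℝ≥0∞)
    (hT : ∀ t : ℝ≥0, MeasurableSet[ℱ t] {ω | T ω ≤ (t : ℝ≥0∞)})
    (hCT : ∀ ω ∈ C, T ω ≠ ∞)
    (z : ℝ≥0 → Ω → ℝ) (hzm : ∀ t, Measurable[ℱ t] (z t))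
    (hval : ∀ t ω, z t ω ∈ Set.Icc (0 : ℝ) 1)
    (hzc : ∀ ω, Continuous fun t => z t ω)
    (hzS : ∀ t S, MeasurableSet[ℱ t] S → ∫⁻ ω in S, ENNReal.ofReal (z t ω) ∂μ = μ (C ∩ S))
    (γ : ℝ) (hγ : 0 < γ) :
    ∫⁻ ω, C.indicator (fun _ => (1 : ℝ≥0∞)) ω *
            ENNReal.ofReal (Real.log (1 / infAfter z T ω) ^ γ) ∂μ ≤
    ENNReal.ofReal (2 ^ γ) * (∫⁻ ω, C.indicator (fun _ => (1 : ℝ≥0∞)) ω *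
            ENNReal.ofReal (Real.log (1 / z (T ω).toNNReal ω) ^ γ) ∂μ +
      (∑' k : ℕ, ENNReal.ofReal (((k : ℝ) + 1) ^ γ) * ENNReal.ofReal (Real.exp (-(k : ℝ)))) * μ C) := by
  let F : ℕ → Set Ω := fun k => C ∩ {ω | ∃ t : ℝ≥0, T ω ≤ t ∧
    z t ω < Real.exp (-(k : ℝ)) * z (T ω).toNNReal ω}
  have hF : ∀ k, μ (F k) ≤ ENNReal.ofReal (Real.exp (-(k : ℝ))) * μ C := by
    intro k
    have := key_cont μ (μ.restrict C) ℱ C T hT z z hzm hzm hzc hzc hzS (fun t S hS => by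
      rw [hzS t S hS, Measure.restrict_apply (ℱ.le t _ hS), Set.inter_comm])
      (Real.exp (-(k : ℝ))) (Real.exp_nonneg _)
    simpa using this
  let G : ℕ → Set Ω := fun k => toMeasurable μ (F k)
  have hGm : ∀ k, MeasurableSet (G k) := fun k => measurableSet_toMeasurable _ _
  let f : ℕ → Ω → ℝ≥0∞ := fun k => (G k).indicator (fun _ => ENNReal.ofReal (((k : ℝ) + 1) ^ γ))
  have hfm : ∀ k, Measurable (f k) := fun k => measurable_const.indicator (hGm k)
  have hpt : ∀ᵐ ω ∂μ, C.indicator (fun _ => (1 : ℝ≥0∞)) ω *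
      ENNReal.ofReal (Real.log (1 / infAfter z T ω) ^ γ) ≤ ENNReal.ofReal (2 ^ γ) *
      (C.indicator (fun _ => (1 : ℝ≥0∞)) ω *
        ENNReal.ofReal (Real.log (1 / z (T ω).toNNReal ω) ^ γ) + ∑' k, f k ω) := by
    filter_upwards [key_pos μ ℱ C T hT hCT z hzm hzc hzS] with ω hpos
    by_cases hω : ω ∈ C
    swap
    · simp [hω]
    have hI := hpos hω
    have hIz := infAfter_le z T ω (fun t => (hval t ω).1) (hCT ω hω)
    have hz1 := (hval (T ω).toNNReal ω).2
    simp only [Set.indicator_of_mem hω, one_mul]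
    generalize hzz : z (T ω).toNNReal ω = x at hIz hz1 ⊢
    have hx : 0 < x := hI.trans_le hIz
    have hlog : Real.log (1 / infAfter z T ω) =
        Real.log (1 / x) + Real.log (x / infAfter z T ω) := by
      rw [← Real.log_mul (by positivity) (by positivity)]
      congr 1; field_simp
    have h1 : 0 ≤ Real.log (1 / x) := Real.log_nonneg (by rw [le_div_iff₀ hx]; linarith)
    have h2 : 0 ≤ Real.log (x / infAfter z T ω) :=
      Real.log_nonneg (by rw [le_div_iff₀ hI]; linarith)
    have hL : ENNReal.ofReal (Real.log (x / infAfter z T ω) ^ γ) ≤ ∑' k, f k ω := by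
      rcases h2.eq_or_lt with h0 | h0
      · rw [← h0, Real.zero_rpow hγ.ne']; simp
      obtain ⟨k, hk⟩ : ∃ k, ⌈Real.log (x / infAfter z T ω)⌉₊ = k + 1 :=
        Nat.exists_eq_succ_of_ne_zero (Nat.ceil_pos.2 h0).ne'
      have hk1 : Real.log (x / infAfter z T ω) ≤ (k : ℝ) + 1 := by
        have := Nat.le_ceil (Real.log (x / infAfter z T ω))
        rw [hk] at this; exact_mod_cast this
      have hk2 : (k : ℝ) < Real.log (x / infAfter z T ω) := Nat.lt_ceil.1 (by omega)
      have hmem : ω ∈ G k := by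
        refine subset_toMeasurable _ _ ⟨hω, ?_⟩
        have h3 : infAfter z T ω < Real.exp (-(k : ℝ)) * x := by
          rw [Real.lt_log_iff_exp_lt (by positivity), lt_div_iff₀ hI] at hk2
          rw [Real.exp_neg, inv_mul_eq_div, lt_div_iff₀ (Real.exp_pos _)]
          linarith
        haveI : Nonempty {t : ℝ≥0 // T ω ≤ (t : ℝ≥0∞)} :=
          ⟨⟨(T ω).toNNReal, (ENNReal.coe_toNNReal (hCT ω hω)).ge⟩⟩
        obtain ⟨t, ht⟩ := exists_lt_of_ciInf_lt h3
        exact ⟨t.1, t.2, by rw [hzz]; exact ht⟩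
      calc _ ≤ ENNReal.ofReal (((k : ℝ) + 1) ^ γ) :=
            ENNReal.ofReal_le_ofReal (Real.rpow_le_rpow h2 hk1 hγ.le)
        _ = f k ω := by simp only [f]; rw [Set.indicator_of_mem hmem]
        _ ≤ _ := ENNReal.le_tsum k
    calc ENNReal.ofReal (Real.log (1 / infAfter z T ω) ^ γ)
        ≤ ENNReal.ofReal (2 ^ γ * (Real.log (1 / x) ^ γ + Real.log (x / infAfter z T ω) ^ γ)) := by
          rw [hlog]; exact ENNReal.ofReal_le_ofReal (add_rpow_bound _ _ _ h1 h2 hγ)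
      _ = ENNReal.ofReal (2 ^ γ) * (ENNReal.ofReal (Real.log (1 / x) ^ γ) +
            ENNReal.ofReal (Real.log (x / infAfter z T ω) ^ γ)) := by
          rw [ENNReal.ofReal_mul (by positivity), ENNReal.ofReal_add (by positivity) (by positivity)]
      _ ≤ _ := by gcongr
  refine (lintegral_mono_ae hpt).trans ?_
  rw [lintegral_const_mul' _ _ ENNReal.ofReal_ne_top,
    lintegral_add_right _ (Measurable.tsum hfm),
    lintegral_tsum fun k => (hfm k).aemeasurable, ← ENNReal.tsum_mul_right]
  gcongr with k
  simp only [f]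
  rw [lintegral_indicator_const (hGm k), measure_toMeasurable, mul_assoc]
  gcongr
  exact hF k

lemma key_lower {Ω : Type*} {𝒢 : MeasurableSpace Ω} (μ : Measure Ω) [IsProbabilityMeasure μ]
    (ℱ : Filtration ℝ≥0 𝒢) (C : Set Ω) (T : Ω → ℝ≥0∞)
    (hT : ∀ t : ℝ≥0, MeasurableSet[ℱ t] {ω | T ω ≤ (t : ℝ≥0∞)})
    (hCT : ∀ ω ∈ C, T ω ≠ ∞)
    (z : ℝ≥0 → Ω → ℝ) (hzm : ∀ t, Measurable[ℱ t] (z t))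
    (hval : ∀ t ω, z t ω ∈ Set.Icc (0 : ℝ) 1)
    (hzc : ∀ ω, Continuous fun t => z t ω)
    (hzS : ∀ t S, MeasurableSet[ℱ t] S → ∫⁻ ω in S, ENNReal.ofReal (z t ω) ∂μ = μ (C ∩ S))
    (γ : ℝ) (hγ : 0 < γ) :
    ∫⁻ ω, C.indicator (fun _ => (1 : ℝ≥0∞)) ω *
            ENNReal.ofReal (Real.log (1 / z (T ω).toNNReal ω) ^ γ) ∂μ ≤
    ∫⁻ ω, C.indicator (fun _ => (1 : ℝ≥0∞)) ω *
            ENNReal.ofReal (Real.log (1 / infAfter z T ω) ^ γ) ∂μ := by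
  refine lintegral_mono_ae ?_
  filter_upwards [key_pos μ ℱ C T hT hCT z hzm hzc hzS] with ω hpos
  by_cases hω : ω ∈ C
  swap
  · simp [hω]
  have hI := hpos hω
  have hIz := infAfter_le z T ω (fun t => (hval t ω).1) (hCT ω hω)
  have hz1 := (hval (T ω).toNNReal ω).2
  have hx := hI.trans_le hIz
  gcongr
  exact Real.log_nonneg (by rw [le_div_iff₀ hx]; linarith)

/-- Let `τ` be a thin random time with exhausting sequence `(T_n)` and let
`ξ` be an `ℕ`-valued (`ξ ≥ 1`) random variable; set `C_n^k := {τ = T_n < ∞} ∩ {ξ = k}` and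
let `z^{n,k}` be continuous `[0,1]`-valued martingale versions of `P(C_n^k | F_t)`. Then for
every `γ > 0`, the `γ`-entropy `H_γ(ξ, τ) = Σ_{n,k} E[1_{C_n^k} (log(1/z^{n,k}_{T_n}))^γ]`
is finite if and only if `Σ_{n,k} E[1_{C_n^k} (log(1/ inf_{t ≥ T_n} z^{n,k}_t))^γ]` is
finite. -/
theorem entropy_finite_iff_moment_log_inf_finite
    {Ω : Type*} {𝒢 : MeasurableSpace Ω} (μ : Measure Ω) [IsProbabilityMeasure μ]
    (ℱ : Filtration ℝ≥0 𝒢)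
    (τ : Ω → ℝ≥0∞) (hτ : Measurable τ)
    (T : ℕ → Ω → ℝ≥0∞)
    (hT : ∀ n, ∀ t : ℝ≥0, MeasurableSet[ℱ t] {ω | T n ω ≤ (t : ℝ≥0∞)})
    (hdisj : ∀ n m, n ≠ m → {ω | T n ω = T m ω ∧ T n ω < ∞} = ∅)
    (hexh : {ω | τ ω < ∞} ⊆ ⋃ n, {ω | τ ω = T n ω})
    (ξ : Ω → ℕ) (hξm : Measurable ξ) (hξ : ∀ ω, 1 ≤ ξ ω)
    (C : ℕ → ℕ → Set Ω)
    (hC : ∀ n k, C n k = {ω | τ ω = T n ω ∧ τ ω < ∞ ∧ ξ ω = k})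
    (z : ℕ → ℕ → ℝ≥0 → Ω → ℝ)
    (hmart : ∀ n k, Martingale (z n k) ℱ μ)
    (hcont : ∀ n k ω, Continuous fun t : ℝ≥0 => z n k t ω)
    (hval : ∀ n k t ω, z n k t ω ∈ Set.Icc (0 : ℝ) 1)
    (hz : ∀ n k, ∀ t : ℝ≥0,
      z n k t =ᵐ[μ] μ[(C n k).indicator (fun _ => (1 : ℝ)) | ℱ t])
    (γ : ℝ) (hγ : 0 < γ) :
    (∑' n : ℕ, ∑' k : ℕ,
        ∫⁻ ω, (C n k).indicator (fun _ => (1 : ℝ≥0∞)) ω *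
          ENNReal.ofReal (Real.log (1 / z n k (T n ω).toNNReal ω) ^ γ) ∂μ) < ∞
      ↔ (∑' n : ℕ, ∑' k : ℕ,
          ∫⁻ ω, (C n k).indicator (fun _ => (1 : ℝ≥0∞)) ω *
            ENNReal.ofReal (Real.log (1 / infAfter (z n k) (T n) ω) ^ γ) ∂μ) < ∞ := by
  have hTm : ∀ n, Measurable (T n) := by
    intro n
    refine measurable_of_Iic fun x => ?_
    rcases eq_or_ne x ∞ with rfl | hx
    · simp
    · have := ℱ.le _ _ (hT n x.toNNReal)
      rwa [ENNReal.coe_toNNReal hx] at this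
  have hCm : ∀ n k, MeasurableSet (C n k) := by
    intro n k
    rw [hC]
    exact (measurableSet_eq_fun hτ (hTm n)).inter
      ((measurableSet_lt hτ measurable_const).inter (hξm (measurableSet_singleton k)))
  have hCT : ∀ n k, ∀ ω ∈ C n k, T n ω ≠ ∞ := by
    intro n k ω hω
    rw [hC] at hω
    rw [← hω.1]
    exact hω.2.1.ne
  have hzm : ∀ n k t, Measurable[ℱ t] (z n k t) := fun n k t =>
    ((hmart n k).1 t).measurable
  have hzS := fun n k => key_S μ ℱ (C n k) (hCm n k) (z n k) (hmart n k) (hval n k) (hz n k)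
  have hsum : ∑' n, ∑' k, μ (C n k) ≤ 1 := by
    rw [← ENNReal.tsum_prod]
    refine (tsum_measure_le_measure_univ (s := fun p : ℕ × ℕ => C p.1 p.2)
      (fun p => (hCm p.1 p.2).nullMeasurableSet) ?_).trans_eq measure_univ
    rintro ⟨n, k⟩ ⟨m, l⟩ hne
    refine Disjoint.aedisjoint (Set.disjoint_left.2 fun ω h1 h2 => hne ?_)
    simp only [hC, Set.mem_setOf_eq] at h1 h2
    have hkl : k = l := h1.2.2.symm.trans h2.2.2
    have hnm : n = m := by
      by_contra h
      have : ω ∈ {ω | T n ω = T m ω ∧ T n ω < ∞} := ⟨h1.1.symm.trans h2.1, h1.1 ▸ h1.2.1⟩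
      rw [hdisj n m h] at this
      exact this
    rw [hkl, hnm]
  constructor
  · intro h
    refine lt_of_le_of_lt (ENNReal.tsum_le_tsum fun n => ENNReal.tsum_le_tsum fun k =>
      key_upper μ ℱ (C n k) (hCm n k) (T n) (hT n) (hCT n k) (z n k) (hzm n k) (hval n k)
        (hcont n k) (hzS n k) γ hγ) ?_
    simp_rw [ENNReal.tsum_mul_left, ENNReal.tsum_add, ENNReal.tsum_mul_left]
    refine ENNReal.mul_lt_top ENNReal.ofReal_lt_top (ENNReal.add_lt_top.2 ⟨h, ?_⟩)
    exact ENNReal.mul_lt_top (const_fin γ hγ).lt_top (hsum.trans_lt ENNReal.one_lt_top)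
  · refine lt_of_le_of_lt (ENNReal.tsum_le_tsum fun n => ENNReal.tsum_le_tsum fun k =>
      key_lower μ ℱ (C n k) (T n) (hT n) (hCT n k) (z n k) (hzm n k) (hval n k)
        (hcont n k) (hzS n k) γ hγ)
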